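/- arXiv:1309.0435 — 2 statements merged into one kernel-verified Lean document; each statement's English description precedes it below -/
import Mathlib

section
/- Let G be a simple graph and let {b1, b2, b3} be a triangle of G. For i = 1,2,3 let Xi be the set of vertices of G that are adjacent to bi and not adjacent to the other two vertices bj (j ≠ i), and let X be the set of vertices of G adjacent to none of b1, b2, b3. Suppose that no vertex of any Xi has a neighbour in each of the other two sets Xj. If some connected component H of the subgraph of G induced by X contains, for each i = 1,2,3, a vertex having a neighbour in Xi, then G contains an induced pyramid or an induced prism. -/
open SimpleGraph

/-- A walk is a *chordless (induced) path*: it is a path and the only edges of `G`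
between its vertices are the edges of the walk. -/
def IsInducedPathW {V : Type*} (G : SimpleGraph V) {u v : V} (p : G.Walk u v) : Prop :=
  p.IsPath ∧ ∀ x y : V, x ∈ p.support → y ∈ p.support → G.Adj x y → p.toSubgraph.Adj x y

/-- A closed walk is a *hole*: an induced (chordless) cycle with at least 4 vertices. -/
def IsHoleW {V : Type*} (G : SimpleGraph V) {v : V} (c : G.Walk v v) : Prop :=
  c.IsCycle ∧ 4 ≤ c.length ∧
    ∀ x y : V, x ∈ c.support → y ∈ c.support → G.Adj x y → c.toSubgraph.Adj x y

/-- `G` contains an odd hole. -/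
def HasOddHole {V : Type*} (G : SimpleGraph V) : Prop :=
  ∃ (v : V) (c : G.Walk v v), IsHoleW G c ∧ Odd c.length

/-- Compatibility condition for two legs of a pyramid with apex `a`:
they meet only at `a`, and `bᵢbⱼ` is the only edge between them away from `a`. -/
def PyrPair {V : Type*} (G : SimpleGraph V) (a bi bj : V)
    (Pi : G.Walk a bi) (Pj : G.Walk a bj) : Prop :=
  (∀ x : V, x ∈ Pi.support → x ∈ Pj.support → x = a) ∧
  (∀ x ∈ Pi.support, ∀ y ∈ Pj.support, x ≠ a → y ≠ a → G.Adj x y → x = bi ∧ y = bj)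

/-- The three paths `P₁, P₂, P₃` form a *pyramid* of `G` with triangle `{b₁,b₂,b₃}`
and apex `a`. -/
def IsPyramid {V : Type*} (G : SimpleGraph V) (a b₁ b₂ b₃ : V)
    (P₁ : G.Walk a b₁) (P₂ : G.Walk a b₂) (P₃ : G.Walk a b₃) : Prop :=
  IsInducedPathW G P₁ ∧ IsInducedPathW G P₂ ∧ IsInducedPathW G P₃ ∧
  G.Adj b₁ b₂ ∧ G.Adj b₂ b₃ ∧ G.Adj b₁ b₃ ∧
  ¬(G.Adj a b₁ ∧ G.Adj a b₂) ∧ ¬(G.Adj a b₁ ∧ G.Adj a b₃) ∧ ¬(G.Adj a b₂ ∧ G.Adj a b₃) ∧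
  PyrPair G a b₁ b₂ P₁ P₂ ∧ PyrPair G a b₁ b₃ P₁ P₃ ∧ PyrPair G a b₂ b₃ P₂ P₃

/-- Compatibility condition for two paths of a prism: they are vertex-disjoint and
the only edges between them are the two triangle edges `aᵢaⱼ` and `bᵢbⱼ`. -/
def PriPair {V : Type*} (G : SimpleGraph V) (ai bi aj bj : V)
    (Pi : G.Walk ai bi) (Pj : G.Walk aj bj) : Prop :=
  (∀ x : V, x ∈ Pi.support → x ∉ Pj.support) ∧
  (∀ x ∈ Pi.support, ∀ y ∈ Pj.support, G.Adj x y → (x = ai ∧ y = aj) ∨ (x = bi ∧ y = bj))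

/-- The three paths `P₁, P₂, P₃` form a *prism* of `G` with triangles `{a₁,a₂,a₃}`
and `{b₁,b₂,b₃}`. -/
def IsPrism {V : Type*} (G : SimpleGraph V) (a₁ a₂ a₃ b₁ b₂ b₃ : V)
    (P₁ : G.Walk a₁ b₁) (P₂ : G.Walk a₂ b₂) (P₃ : G.Walk a₃ b₃) : Prop :=
  IsInducedPathW G P₁ ∧ IsInducedPathW G P₂ ∧ IsInducedPathW G P₃ ∧
  G.Adj a₁ a₂ ∧ G.Adj a₂ a₃ ∧ G.Adj a₁ a₃ ∧
  G.Adj b₁ b₂ ∧ G.Adj b₂ b₃ ∧ G.Adj b₁ b₃ ∧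
  a₁ ≠ b₁ ∧ a₂ ≠ b₂ ∧ a₃ ≠ b₃ ∧
  PriPair G a₁ b₁ a₂ b₂ P₁ P₂ ∧ PriPair G a₁ b₁ a₃ b₃ P₁ P₃ ∧ PriPair G a₂ b₂ a₃ b₃ P₂ P₃

/-- `G` contains an induced pyramid. -/
def HasPyramid {V : Type*} (G : SimpleGraph V) : Prop :=
  ∃ (a b₁ b₂ b₃ : V) (P₁ : G.Walk a b₁) (P₂ : G.Walk a b₂) (P₃ : G.Walk a b₃),
    IsPyramid G a b₁ b₂ b₃ P₁ P₂ P₃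

/-- `G` contains an induced prism. -/
def HasPrism {V : Type*} (G : SimpleGraph V) : Prop :=
  ∃ (a₁ a₂ a₃ b₁ b₂ b₃ : V) (P₁ : G.Walk a₁ b₁) (P₂ : G.Walk a₂ b₂) (P₃ : G.Walk a₃ b₃),
    IsPrism G a₁ a₂ a₃ b₁ b₂ b₃ P₁ P₂ P₃

/-- `G` has an induced pyramid whose vertex set is exactly `S`. -/
def HasPyramidOn {V : Type*} [DecidableEq V] (G : SimpleGraph V) (S : Finset V) : Prop :=
  ∃ (a b₁ b₂ b₃ : V) (P₁ : G.Walk a b₁) (P₂ : G.Walk a b₂) (P₃ : G.Walk a b₃),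
    IsPyramid G a b₁ b₂ b₃ P₁ P₂ P₃ ∧
    P₁.support.toFinset ∪ P₂.support.toFinset ∪ P₃.support.toFinset = S

/-- `G` has an induced prism whose vertex set is exactly `S`. -/
def HasPrismOn {V : Type*} [DecidableEq V] (G : SimpleGraph V) (S : Finset V) : Prop :=
  ∃ (a₁ a₂ a₃ b₁ b₂ b₃ : V) (P₁ : G.Walk a₁ b₁) (P₂ : G.Walk a₂ b₂) (P₃ : G.Walk a₃ b₃),
    IsPrism G a₁ a₂ a₃ b₁ b₂ b₃ P₁ P₂ P₃ ∧
    P₁.support.toFinset ∪ P₂.support.toFinset ∪ P₃.support.toFinset = S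

theorem ind_nil {V : Type*} (G : SimpleGraph V) (u : V) :
    IsInducedPathW G (Walk.nil : G.Walk u u) := by
  refine ⟨by simp, ?_⟩
  intro x y hx hy h
  simp at hx hy
  subst hx; subst hy
  exact absurd h (G.loopless.irrefl _)

theorem ind_cons {V : Type*} (G : SimpleGraph V) {u w v : V} (h : G.Adj u w) (p : G.Walk w v) :
    IsInducedPathW G (Walk.cons h p) ↔
      IsInducedPathW G p ∧ u ∉ p.support ∧ ∀ y ∈ p.support, G.Adj u y → y = w := by
  constructor
  · rintro ⟨hp, hi⟩
    rw [Walk.cons_isPath_iff] at hp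
    have key : ∀ x y, G.Adj x y → x ∈ p.support → y ∈ p.support → x ≠ u → y ≠ u →
        p.toSubgraph.Adj x y := by
      intro x y hxy hx hy hxu hyu
      have := hi x y (by simp [hx]) (by simp [hy]) hxy
      simp [Walk.toSubgraph, hxu, hyu] at this
      rcases this with h | h
      · rcases h with h | h <;> [exact absurd h.1.symm hxu; exact absurd h.1.symm hyu]
      · exact h
    refine ⟨⟨hp.1, ?_⟩, hp.2, ?_⟩
    · intro x y hx hy hxy
      exact key x y hxy hx hy (fun e => hp.2 (e ▸ hx)) (fun e => hp.2 (e ▸ hy))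
    · intro y hy hxy
      have := hi u y (by simp) (by simp [hy]) hxy
      simp [Walk.toSubgraph] at this
      rcases this with (h | h) | h
      · exact h.symm
      · exact absurd (h.1 ▸ hy) hp.2
      · exact absurd (p.mem_verts_toSubgraph.1 (p.toSubgraph.edge_vert h)) hp.2
  · rintro ⟨⟨hp, hi⟩, hu, hn⟩
    refine ⟨(Walk.cons_isPath_iff _ _).2 ⟨hp, hu⟩, ?_⟩
    intro x y hx hy hxy
    simp only [Walk.support_cons, List.mem_cons] at hx hy
    rcases hx with rfl | hx
    · rcases hy with rfl | hy
      · exact absurd hxy (G.loopless.irrefl _)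
      · have := hn y hy hxy
        subst this
        simp [Walk.toSubgraph]
    · rcases hy with rfl | hy
      · have := hn x hx hxy.symm
        subst this
        simp [Walk.toSubgraph]
      · have := hi x y hx hy hxy
        simp [Walk.toSubgraph, this]

theorem ind_concat {V : Type*} (G : SimpleGraph V) {u v b : V} (p : G.Walk u v) (h : G.Adj v b)
    (hp : IsInducedPathW G p) (hb : b ∉ p.support) (hn : ∀ y ∈ p.support, G.Adj y b → y = v) :
    IsInducedPathW G (p.concat h) := by
  have hrev : ∀ {s t : V} (q : G.Walk s t), IsInducedPathW G q → IsInducedPathW G q.reverse := by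
    intro s t q hq
    refine ⟨hq.1.reverse, ?_⟩
    intro x y hx hy hxy
    simp at hx hy
    simpa using hq.2 x y hx hy hxy
  have h1 : IsInducedPathW G (Walk.cons h.symm p.reverse) := by
    rw [ind_cons]
    refine ⟨hrev p hp, by simpa using hb, ?_⟩
    intro y hy hby
    exact hn y (by simpa using hy) hby.symm
  have := hrev _ h1
  rwa [Walk.reverse_cons, Walk.reverse_reverse, ← Walk.concat_eq_append] at this

/-- The final part of an induced path, from the last vertex satisfying `N`. -/
theorem last_part {V : Type*} (G : SimpleGraph V) (N : V → Prop) {u v : V} (p : G.Walk u v)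
    (hp : IsInducedPathW G p) (hN : ∃ x ∈ p.support, N x) :
    ∃ (x : V) (q : G.Walk x v), IsInducedPathW G q ∧ (∀ y ∈ q.support, y ∈ p.support) ∧ N x ∧
      (∀ y ∈ q.support, N y → y = x) ∧ (u ∈ q.support → x = u) := by
  induction p with
  | nil =>
    obtain ⟨x, hx, hN⟩ := hN
    simp at hx
    subst hx
    exact ⟨_, Walk.nil, ind_nil G _, by simp, hN, by simp, by simp⟩
  | @cons u w v h p ih =>
    have hp' := (ind_cons G h p).1 hp
    by_cases hex : ∃ x ∈ p.support, N x
    · obtain ⟨x, q, h1, h2, h3, h4, h5⟩ := ih hp'.1 hex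
      refine ⟨x, q, h1, fun y hy => by simp [h2 y hy], h3, h4, ?_⟩
      intro hu
      exact absurd (h2 u hu) hp'.2.1
    · push Not at hex
      obtain ⟨x, hx, hNx⟩ := hN
      simp only [Walk.support_cons, List.mem_cons] at hx
      rcases hx with rfl | hx
      · refine ⟨_, Walk.cons h p, hp, fun y hy => hy, hNx, ?_, fun _ => rfl⟩
        intro y hy hNy
        simp only [Walk.support_cons, List.mem_cons] at hy
        rcases hy with rfl | hy
        · rfl
        · exact absurd hNy (hex y hy)
      · exact absurd hNx (hex x hx)

/-- Extraction of an induced path from a walk. -/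
theorem exists_ind {V : Type*} (G : SimpleGraph V) {u v : V} (p : G.Walk u v) :
    ∃ q : G.Walk u v, IsInducedPathW G q ∧ ∀ y ∈ q.support, y ∈ p.support := by
  induction p with
  | nil => exact ⟨Walk.nil, ind_nil G _, by simp⟩
  | @cons u w v h p ih =>
    obtain ⟨q, hq, hs⟩ := ih
    by_cases hu : u ∈ q.support
    · obtain ⟨x, r, h1, h2, h3, -, -⟩ := last_part G (fun x => x = u) q hq ⟨u, hu, rfl⟩
      subst h3
      exact ⟨r, h1, fun y hy => by simp [hs y (h2 y hy)]⟩
    · obtain ⟨x, r, h1, h2, h3, h4, -⟩ := last_part G (fun x => G.Adj u x) q hq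
        ⟨w, q.start_mem_support, h⟩
      refine ⟨Walk.cons h3 r, (ind_cons G h3 r).2 ⟨h1, fun hu' => hu (h2 u hu'), h4⟩, ?_⟩
      intro y hy
      simp only [Walk.support_cons, List.mem_cons] at hy ⊢
      rcases hy with rfl | hy
      · exact Or.inl rfl
      · exact Or.inr (hs y (h2 y hy))

/-- How the vertices satisfying `N` split an induced path. -/
theorem split_path {V : Type*} (G : SimpleGraph V) (N : V → Prop) {u v : V} (p : G.Walk u v)
    (hp : IsInducedPathW G p) (hN : ∃ x ∈ p.support, N x) :
    ∃ (s t : V) (P : G.Walk s u) (Q : G.Walk t v), IsInducedPathW G P ∧ IsInducedPathW G Q ∧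
      (∀ y ∈ P.support, y ∈ p.support) ∧ (∀ y ∈ Q.support, y ∈ p.support) ∧
      N s ∧ N t ∧ (∀ y ∈ P.support, N y → y = s) ∧ (∀ y ∈ Q.support, N y → y = t) ∧
      ((s = t ∧ (∀ x ∈ P.support, x ∈ Q.support → x = s) ∧
          ∀ x ∈ P.support, ∀ y ∈ Q.support, x ≠ s → y ≠ s → ¬ G.Adj x y) ∨
        (G.Adj s t ∧ (∀ x ∈ P.support, x ∉ Q.support) ∧
          ∀ x ∈ P.support, ∀ y ∈ Q.support, G.Adj x y → x = s ∧ y = t) ∨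
        ((∀ x ∈ P.support, x ∉ Q.support) ∧
          ∀ x ∈ P.support, ∀ y ∈ Q.support, ¬ G.Adj x y)) := by
  induction p with
  | nil =>
    obtain ⟨x, hx, hN⟩ := hN
    simp at hx
    subst hx
    refine ⟨_, _, Walk.nil, Walk.nil, ind_nil G _, ind_nil G _, by simp, by simp, hN, hN,
      by simp, by simp, Or.inl ?_⟩
    simp
  | @cons u w v h p ih =>
    have hp' := (ind_cons G h p).1 hp
    by_cases hex : ∃ x ∈ p.support, N x
    · by_cases hu : N u
      · obtain ⟨t, Q, h1, h2, h3, h4, h5⟩ := last_part G N p hp'.1 hex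
        refine ⟨u, t, Walk.nil, Q, ind_nil G _, h1, by simp,
          fun y hy => by simp [h2 y hy], hu, h3, by simp, h4, Or.inr ?_⟩
        have hd : ∀ x ∈ (Walk.nil : G.Walk u u).support, x ∉ Q.support := by
          intro x hx hxQ
          simp at hx
          subst hx
          exact hp'.2.1 (h2 _ hxQ)
        by_cases htw : t = w
        · subst htw
          refine Or.inl ⟨h, hd, ?_⟩
          intro x hx y hy hxy
          simp at hx
          subst hx
          exact ⟨rfl, hp'.2.2 y (h2 y hy) hxy⟩
        · refine Or.inr ⟨hd, ?_⟩
          intro x hx y hy hxy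
          simp at hx
          subst hx
          have := hp'.2.2 y (h2 y hy) hxy
          subst this
          exact htw (h5 hy)
      · obtain ⟨s, t, P, Q, h1, h2, h3, h4, h5, h6, h7, h8, h9⟩ := ih hp'.1 hex
        have hsup : ∀ x, x ∈ (P.concat h.symm).support ↔ x ∈ P.support ∨ x = u := by
          intro x; simp [Walk.support_concat]
        have hwP : w ∈ P.support := P.end_mem_support
        have huQ : u ∉ Q.support := fun hh => hp'.2.1 (h4 u hh)
        have hus : u ≠ s := fun e => hu (e ▸ h5)
        have hn : ∀ y ∈ Q.support, G.Adj u y → y = w := fun y hy => hp'.2.2 y (h4 y hy)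
        refine ⟨s, t, P.concat h.symm, Q, ?_, h2, ?_, fun y hy => by simp [h4 y hy], h5, h6, ?_,
          h8, ?_⟩
        · apply ind_concat G P h.symm h1 (fun hh => hp'.2.1 (h3 u hh))
          intro y hy hyu
          exact hp'.2.2 y (h3 y hy) hyu.symm
        · intro y hy
          rcases (hsup y).1 hy with hy | rfl
          · simp [h3 y hy]
          · simp
        · intro y hy hNy
          rcases (hsup y).1 hy with hy | rfl
          · exact h7 y hy hNy
          · exact absurd hNy hu
        · simp only [hsup]
          clear hsup ih
          grind
    · push Not at hex
      obtain ⟨x, hx, hNx⟩ := hN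
      simp only [Walk.support_cons, List.mem_cons] at hx
      have hu : N u := by
        rcases hx with rfl | hx
        · exact hNx
        · exact absurd hNx (hex x hx)
      refine ⟨u, u, Walk.nil, Walk.cons h p, ind_nil G _, hp, by simp, fun y hy => hy, hu, hu,
        by simp, ?_, Or.inl ⟨rfl, by simp, by simp⟩⟩
      intro y hy hNy
      simp only [Walk.support_cons, List.mem_cons] at hy
      rcases hy with rfl | hy
      · rfl
      · exact absurd hNy (hex y hy)

/-- `v` sees the triangle `b₁b₂b₃` at most as the corresponding `cᵢ`. -/
def SeesOK {V : Type*} (G : SimpleGraph V) (b₁ b₂ b₃ c₁ c₂ c₃ v : V) : Prop :=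
  (G.Adj v b₁ → v = c₁) ∧ (G.Adj v b₂ → v = c₂) ∧ (G.Adj v b₃ → v = c₃) ∧
    v ≠ b₁ ∧ v ≠ b₂ ∧ v ≠ b₃

theorem mk_pyramid {V : Type*} (G : SimpleGraph V) (a b₁ b₂ b₃ c₁ c₂ c₃ : V)
    (hb₁₂ : G.Adj b₁ b₂) (hb₂₃ : G.Adj b₂ b₃) (hb₁₃ : G.Adj b₁ b₃)
    (hc₁ : G.Adj c₁ b₁) (hc₂ : G.Adj c₂ b₂) (hc₃ : G.Adj c₃ b₃)
    (h₁₂ : c₁ ≠ c₂) (h₂₃ : c₂ ≠ c₃) (h₁₃ : c₁ ≠ c₃)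
    (M₁ : G.Walk a c₁) (M₂ : G.Walk a c₂) (M₃ : G.Walk a c₃)
    (i₁ : IsInducedPathW G M₁) (i₂ : IsInducedPathW G M₂) (i₃ : IsInducedPathW G M₃)
    (s₁ : ∀ x ∈ M₁.support, SeesOK G b₁ b₂ b₃ c₁ c₂ c₃ x)
    (s₂ : ∀ x ∈ M₂.support, SeesOK G b₁ b₂ b₃ c₁ c₂ c₃ x)
    (s₃ : ∀ x ∈ M₃.support, SeesOK G b₁ b₂ b₃ c₁ c₂ c₃ x)
    (d₁₂ : ∀ x ∈ M₁.support, x ∈ M₂.support → x = a)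
    (d₁₃ : ∀ x ∈ M₁.support, x ∈ M₃.support → x = a)
    (d₂₃ : ∀ x ∈ M₂.support, x ∈ M₃.support → x = a)
    (e₁₂ : ∀ x ∈ M₁.support, ∀ y ∈ M₂.support, x ≠ a → y ≠ a → ¬ G.Adj x y)
    (e₁₃ : ∀ x ∈ M₁.support, ∀ y ∈ M₃.support, x ≠ a → y ≠ a → ¬ G.Adj x y)
    (e₂₃ : ∀ x ∈ M₂.support, ∀ y ∈ M₃.support, x ≠ a → y ≠ a → ¬ G.Adj x y) :
    HasPyramid G := by
  have m₁ := M₁.end_mem_support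
  have m₂ := M₂.end_mem_support
  have m₃ := M₃.end_mem_support
  have sa := s₁ a M₁.start_mem_support
  unfold SeesOK at *
  have n₁₂ := hb₁₂.ne
  have n₁₃ := hb₁₃.ne
  have n₂₃ := hb₂₃.ne
  have hsymm : ∀ x y, G.Adj x y → G.Adj y x := fun _ _ h => h.symm
  refine ⟨a, b₁, b₂, b₃, M₁.concat hc₁, M₂.concat hc₂, M₃.concat hc₃,
    ind_concat G _ _ i₁ ?_ ?_, ind_concat G _ _ i₂ ?_ ?_, ind_concat G _ _ i₃ ?_ ?_,
    hb₁₂, hb₂₃, hb₁₃, ?_, ?_, ?_, ⟨?_, ?_⟩, ⟨?_, ?_⟩, ⟨?_, ?_⟩⟩ <;>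
  (try simp only [Walk.support_concat, List.mem_append, List.mem_singleton]) <;>
  grind

theorem mk_prism {V : Type*} (G : SimpleGraph V) (a₁ a₂ a₃ b₁ b₂ b₃ c₁ c₂ c₃ : V)
    (hb₁₂ : G.Adj b₁ b₂) (hb₂₃ : G.Adj b₂ b₃) (hb₁₃ : G.Adj b₁ b₃)
    (hc₁ : G.Adj c₁ b₁) (hc₂ : G.Adj c₂ b₂) (hc₃ : G.Adj c₃ b₃)
    (ha₁₂ : G.Adj a₁ a₂) (ha₂₃ : G.Adj a₂ a₃) (ha₁₃ : G.Adj a₁ a₃)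
    (M₁ : G.Walk a₁ c₁) (M₂ : G.Walk a₂ c₂) (M₃ : G.Walk a₃ c₃)
    (i₁ : IsInducedPathW G M₁) (i₂ : IsInducedPathW G M₂) (i₃ : IsInducedPathW G M₃)
    (s₁ : ∀ x ∈ M₁.support, SeesOK G b₁ b₂ b₃ c₁ c₂ c₃ x)
    (s₂ : ∀ x ∈ M₂.support, SeesOK G b₁ b₂ b₃ c₁ c₂ c₃ x)
    (s₃ : ∀ x ∈ M₃.support, SeesOK G b₁ b₂ b₃ c₁ c₂ c₃ x)
    (d₁₂ : ∀ x ∈ M₁.support, x ∉ M₂.support)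
    (d₁₃ : ∀ x ∈ M₁.support, x ∉ M₃.support)
    (d₂₃ : ∀ x ∈ M₂.support, x ∉ M₃.support)
    (e₁₂ : ∀ x ∈ M₁.support, ∀ y ∈ M₂.support, G.Adj x y → x = a₁ ∧ y = a₂)
    (e₁₃ : ∀ x ∈ M₁.support, ∀ y ∈ M₃.support, G.Adj x y → x = a₁ ∧ y = a₃)
    (e₂₃ : ∀ x ∈ M₂.support, ∀ y ∈ M₃.support, G.Adj x y → x = a₂ ∧ y = a₃) :
    HasPrism G := by
  have m₁ := M₁.end_mem_support
  have m₂ := M₂.end_mem_support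
  have m₃ := M₃.end_mem_support
  have k₁ := M₁.start_mem_support
  have k₂ := M₂.start_mem_support
  have k₃ := M₃.start_mem_support
  unfold SeesOK at *
  have n₁₂ := hb₁₂.ne
  have n₁₃ := hb₁₃.ne
  have n₂₃ := hb₂₃.ne
  have hsymm : ∀ x y, G.Adj x y → G.Adj y x := fun _ _ h => h.symm
  refine ⟨a₁, a₂, a₃, b₁, b₂, b₃, M₁.concat hc₁, M₂.concat hc₂, M₃.concat hc₃,
    ind_concat G _ _ i₁ ?_ ?_, ind_concat G _ _ i₂ ?_ ?_, ind_concat G _ _ i₃ ?_ ?_,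
    ha₁₂, ha₂₃, ha₁₃, hb₁₂, hb₂₃, hb₁₃, ?_, ?_, ?_, ⟨?_, ?_⟩, ⟨?_, ?_⟩, ⟨?_, ?_⟩⟩ <;>
  (try simp only [Walk.support_concat, List.mem_append, List.mem_singleton]) <;>
  grind

/-- Let `{b₁,b₂,b₃}` be a triangle of `G`, let `Xᵢ` be the set of
vertices adjacent to `bᵢ` and to no other `bⱼ`, and let `X` be the set of vertices
adjacent to none of `b₁, b₂, b₃`. If no vertex of any `Xᵢ` has a neighbour in each of
the two other sets `Xⱼ`, and some connected component of the subgraph induced on `X`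
contains, for each `i`, a vertex having a neighbour in `Xᵢ`, then `G` contains an
induced pyramid or an induced prism. -/
theorem triangle_attachments_give_pyramid_or_prism
    {V : Type*} [Fintype V] [DecidableEq V] (G : SimpleGraph V)
    (b₁ b₂ b₃ : V)
    (hb₁₂ : G.Adj b₁ b₂) (hb₂₃ : G.Adj b₂ b₃) (hb₁₃ : G.Adj b₁ b₃)
    (X₁ X₂ X₃ X : Set V)
    (hX₁ : X₁ = {v | G.Adj v b₁ ∧ ¬ G.Adj v b₂ ∧ ¬ G.Adj v b₃})
    (hX₂ : X₂ = {v | G.Adj v b₂ ∧ ¬ G.Adj v b₁ ∧ ¬ G.Adj v b₃})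
    (hX₃ : X₃ = {v | G.Adj v b₃ ∧ ¬ G.Adj v b₁ ∧ ¬ G.Adj v b₂})
    (hX : X = {v | ¬ G.Adj v b₁ ∧ ¬ G.Adj v b₂ ∧ ¬ G.Adj v b₃})
    (hno₁ : ¬ ∃ c₁ ∈ X₁, (∃ c₂ ∈ X₂, G.Adj c₁ c₂) ∧ (∃ c₃ ∈ X₃, G.Adj c₁ c₃))
    (hno₂ : ¬ ∃ c₂ ∈ X₂, (∃ c₁ ∈ X₁, G.Adj c₂ c₁) ∧ (∃ c₃ ∈ X₃, G.Adj c₂ c₃))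
    (hno₃ : ¬ ∃ c₃ ∈ X₃, (∃ c₁ ∈ X₁, G.Adj c₃ c₁) ∧ (∃ c₂ ∈ X₂, G.Adj c₃ c₂))
    (x₁ x₂ x₃ : V) (hx₁ : x₁ ∈ X) (hx₂ : x₂ ∈ X) (hx₃ : x₃ ∈ X)
    (hn₁ : ∃ y ∈ X₁, G.Adj x₁ y) (hn₂ : ∃ y ∈ X₂, G.Adj x₂ y) (hn₃ : ∃ y ∈ X₃, G.Adj x₃ y)
    (hconn₁₂ : ∃ p : G.Walk x₁ x₂, ∀ z ∈ p.support, z ∈ X)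
    (hconn₁₃ : ∃ p : G.Walk x₁ x₃, ∀ z ∈ p.support, z ∈ X) :
    HasPyramid G ∨ HasPrism G := by
  clear hno₁ hno₂ hno₃
  obtain ⟨c₁, hc₁, hxc₁⟩ := hn₁
  obtain ⟨c₂, hc₂, hxc₂⟩ := hn₂
  obtain ⟨c₃, hc₃, hxc₃⟩ := hn₃
  obtain ⟨p₂, hp₂⟩ := hconn₁₂
  obtain ⟨p₃, hp₃⟩ := hconn₁₃
  subst hX₁ hX₂ hX₃ hX
  simp only [Set.mem_setOf_eq] at *
  have h₁₂ : c₁ ≠ c₂ := by rintro rfl; tauto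
  have h₁₃ : c₁ ≠ c₃ := by rintro rfl; tauto
  have h₂₃ : c₂ ≠ c₃ := by rintro rfl; tauto
  have hS : ∀ v, (¬ G.Adj v b₁ ∧ ¬ G.Adj v b₂ ∧ ¬ G.Adj v b₃) ∨ v = c₁ ∨ v = c₂ ∨ v = c₃ →
      SeesOK G b₁ b₂ b₃ c₁ c₂ c₃ v := by
    have hsymm : ∀ x y, G.Adj x y → G.Adj y x := fun _ _ h => h.symm
    intro v hv
    unfold SeesOK
    grind
  -- the path `P` from `c₁` to `c₃`
  obtain ⟨P, hP, hPs⟩ := exists_ind G (Walk.cons hxc₁.symm (p₃.concat hxc₃))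
  have hPs' : ∀ y ∈ P.support, y = c₁ ∨ y = c₃ ∨
      (¬ G.Adj y b₁ ∧ ¬ G.Adj y b₂ ∧ ¬ G.Adj y b₃) := by
    intro y hy
    have := hPs y hy
    simp [Walk.support_concat] at this
    rcases this with h | h | h
    · exact Or.inl h
    · exact Or.inr (Or.inr (hp₃ y h))
    · exact Or.inr (Or.inl h)
  have hc₂P : c₂ ∉ P.support := by
    intro h
    rcases hPs' c₂ h with h | h | h
    · exact h₁₂ h.symm
    · exact h₂₃ h
    · exact h.2.1 hc₂.1
  -- the path `Q` from `c₂` towards `P`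
  obtain ⟨W, hW, hWs⟩ := exists_ind G (Walk.cons hxc₁.symm (p₂.concat hxc₂))
  have hWs' : ∀ y ∈ W.support, y = c₁ ∨ y = c₂ ∨
      (¬ G.Adj y b₁ ∧ ¬ G.Adj y b₂ ∧ ¬ G.Adj y b₃) := by
    intro y hy
    have := hWs y hy
    simp [Walk.support_concat] at this
    rcases this with h | h | h
    · exact Or.inl h
    · exact Or.inr (Or.inr (hp₂ y h))
    · exact Or.inr (Or.inl h)
  obtain ⟨x, W', hW', hW's, hxP, hxu, -⟩ := last_part G (fun z => z ∈ P.support) W hW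
    ⟨c₁, W.start_mem_support, P.start_mem_support⟩
  obtain ⟨q, Q, hQ, hQW, hQP, hqn, hqu⟩ : ∃ (q : V) (Q : G.Walk q c₂), IsInducedPathW G Q ∧
      (∀ y ∈ Q.support, y ∈ W.support) ∧ (∀ y ∈ Q.support, y ∉ P.support) ∧
      (∃ z ∈ P.support, G.Adj q z) ∧
      (∀ y ∈ Q.support, (∃ z ∈ P.support, G.Adj y z) → y = q) := by
    cases W' with
    | nil => exact absurd hxP hc₂P
    | @cons _ w _ h W'' =>
      have hc := (ind_cons G h W'').1 hW'
      obtain ⟨q, Q, g1, g2, g3, g4, -⟩ := last_part G (fun y => ∃ z ∈ P.support, G.Adj y z) W''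
        hc.1 ⟨w, W''.start_mem_support, x, hxP, h.symm⟩
      refine ⟨q, Q, g1, fun y hy => hW's y (by simp [g2 y hy]), ?_, g3, g4⟩
      intro y hy hyP
      have := hxu y (by simp [g2 y hy]) hyP
      subst this
      exact hc.2.1 (g2 y hy)
  have sQ : ∀ y ∈ Q.support, SeesOK G b₁ b₂ b₃ c₁ c₂ c₃ y := by
    intro y hy
    apply hS
    have := hWs' y (hQW y hy)
    tauto
  have sP : ∀ y ∈ P.support, SeesOK G b₁ b₂ b₃ c₁ c₂ c₃ y := by
    intro y hy
    apply hS
    have := hPs' y hy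
    tauto
  obtain ⟨s, t, L, R, iL, iR, hL, hR, hqs, hqt, uL, uR, hcase⟩ :=
    split_path G (fun z => G.Adj q z) P hP hqn
  have hsymm : ∀ x y, G.Adj x y → G.Adj y x := fun _ _ h => h.symm
  have hqQ := Q.start_mem_support
  have hsL := L.start_mem_support
  have htR := R.start_mem_support
  have sL := fun y hy => sP y (hL y hy)
  have sR := fun y hy => sP y (hR y hy)
  -- edges between `Q` and `L`, `R`
  have eL : ∀ y ∈ L.support, ∀ z ∈ Q.support, G.Adj y z → y = s ∧ z = q := by
    intro y hy z hz hyz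
    have h1 := hqu z hz ⟨y, hL y hy, hyz.symm⟩
    subst h1
    exact ⟨uL y hy hyz.symm, rfl⟩
  have eR : ∀ y ∈ R.support, ∀ z ∈ Q.support, G.Adj y z → y = t ∧ z = q := by
    intro y hy z hz hyz
    have h1 := hqu z hz ⟨y, hR y hy, hyz.symm⟩
    subst h1
    exact ⟨uR y hy hyz.symm, rfl⟩
  have dL : ∀ y ∈ L.support, y ∉ Q.support := fun y hy hz => hQP y hz (hL y hy)
  have dR : ∀ y ∈ R.support, y ∉ Q.support := fun y hy hz => hQP y hz (hR y hy)
  rcases hcase with ⟨rfl, d, e⟩ | ⟨hst, d, e⟩ | ⟨d, e⟩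
  · left
    refine mk_pyramid G s b₁ b₂ b₃ c₁ c₂ c₃ hb₁₂ hb₂₃ hb₁₃ hc₁.1 hc₂.1 hc₃.1 h₁₂ h₂₃ h₁₃
      L (Walk.cons hqs.symm Q) R iL
      ((ind_cons G _ _).2 ⟨hQ, dL s hsL, fun y hy h => (eL s hsL y hy h).2⟩) iR sL ?_ sR
      ?_ d ?_ ?_ e ?_ <;>
    simp only [Walk.support_cons, List.mem_cons] <;> grind
  · right
    refine mk_prism G s q t b₁ b₂ b₃ c₁ c₂ c₃ hb₁₂ hb₂₃ hb₁₃ hc₁.1 hc₂.1 hc₃.1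
      hqs.symm hqt hst L Q R iL hQ iR sL sQ sR dL d ?_ eL e ?_
    · intro y hy hz
      exact dR y hz hy
    · intro y hy z hz hyz
      exact (eR z hz y hy hyz.symm).symm
  · left
    refine mk_pyramid G q b₁ b₂ b₃ c₁ c₂ c₃ hb₁₂ hb₂₃ hb₁₃ hc₁.1 hc₂.1 hc₃.1 h₁₂ h₂₃ h₁₃
      (Walk.cons hqs L) Q (Walk.cons hqt R)
      ((ind_cons G _ _).2 ⟨iL, fun h => dL q h hqQ, uL⟩) hQ
      ((ind_cons G _ _).2 ⟨iR, fun h => dR q h hqQ, uR⟩) ?_ sQ ?_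
      ?_ ?_ ?_ ?_ ?_ ?_ <;>
    simp only [Walk.support_cons, List.mem_cons] <;> grind
end

section
/- Let G be a triangle-free simple graph and let a, b be two non-adjacent vertices of G, each of degree 2; let a', a'' be the two neighbours of a and b', b'' the two neighbours of b. Let G' be the graph obtained from G as follows: delete a and replace it by five new vertices a1, a2, a3, a4, a5 with the five edges a1a2, a1a3, a2a3, a2a4, a3a5, together with the edges a4a' and a5a''; do the same for b, with five new vertices b1, ..., b5 and the analogous edges (b1b2, b1b3, b2b3, b2b4, b3b5, b4b', b5b''); finally add the edge a1b1. Then G' contains an induced prism if and only if G contains a hole passing through both a and b. -/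
open SimpleGraph

/-- The graph `G'` of the reduction: delete the two degree-two vertices `a` and `b`
of `G`, replace each of them by a gadget of five new vertices (`a₁,…,a₅` are the
coordinates `0,…,4` of `Fin 10` and `b₁,…,b₅` the coordinates `5,…,9`), attach the
gadgets to the former neighbours `a', a''` of `a` and `b', b''` of `b`, and add the
edge `a₁b₁`. -/
def prismGadget {V : Type*} [DecidableEq V] (G : SimpleGraph V) (a b a' a'' b' b'' : V) :
    SimpleGraph ({v : V // v ≠ a ∧ v ≠ b} ⊕ Fin 10) :=
  SimpleGraph.fromRel (fun x y =>
    match x, y with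
    | Sum.inl u, Sum.inl v => G.Adj u.1 v.1
    | Sum.inr i, Sum.inl u =>
        (i = 3 ∧ u.1 = a') ∨ (i = 4 ∧ u.1 = a'') ∨ (i = 8 ∧ u.1 = b') ∨ (i = 9 ∧ u.1 = b'')
    | Sum.inl _, Sum.inr _ => False
    | Sum.inr i, Sum.inr j =>
        (i = 0 ∧ j = 1) ∨ (i = 0 ∧ j = 2) ∨ (i = 1 ∧ j = 2) ∨ (i = 1 ∧ j = 3) ∨
        (i = 2 ∧ j = 4) ∨ (i = 5 ∧ j = 6) ∨ (i = 5 ∧ j = 7) ∨ (i = 6 ∧ j = 7) ∨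
        (i = 6 ∧ j = 8) ∨ (i = 7 ∧ j = 9) ∨ (i = 0 ∧ j = 5))


theorem exists_induced_sub {V : Type*} (G : SimpleGraph V) {u v : V} (p : G.Walk u v) :
    ∃ q : G.Walk u v, IsInducedPathW G q ∧ ∀ x ∈ q.support, x ∈ p.support := by
  classical
  have hex : ∃ n, ∃ q : G.Walk u v, q.length = n ∧ ∀ x ∈ q.support, x ∈ p.support :=
    ⟨_, p, rfl, fun _ h => h⟩
  obtain ⟨q₀, hq₀, hs₀⟩ := Nat.find_spec hex
  have hmin : ∀ q : G.Walk u v, (∀ x ∈ q.support, x ∈ p.support) →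
      Nat.find hex ≤ q.length := fun q hq => Nat.find_min' hex ⟨q, rfl, hq⟩
  have hs : ∀ x ∈ q₀.bypass.support, x ∈ p.support := fun x hx =>
    hs₀ x (q₀.support_bypass_subset_support hx)
  have hlen : q₀.bypass.length = Nat.find hex :=
    le_antisymm (hq₀ ▸ q₀.length_bypass_le_length) (hmin _ hs)
  refine ⟨q₀.bypass, ⟨q₀.bypass_isPath, ?_⟩, hs⟩
  generalize q₀.bypass = q at hs hlen
  have key : ∀ i j, i < j → j ≤ q.length → G.Adj (q.getVert i) (q.getVert j) →
      q.toSubgraph.Adj (q.getVert i) (q.getVert j) := by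
    intro i j hij hj hadj
    by_cases h1 : j = i + 1
    · subst h1
      exact q.toSubgraph_adj_getVert (by omega)
    · exfalso
      have := hmin ((q.take i).append (Walk.cons hadj (q.drop j))) (by
        intro x hx
        apply hs
        rw [Walk.mem_support_append_iff, Walk.support_cons, List.mem_cons] at hx
        rcases hx with hx | rfl | hx
        · rw [Walk.support_take] at hx
          exact List.mem_of_mem_take hx
        · exact q.getVert_mem_support i
        · rw [Walk.drop_support_eq_support_drop_min] at hx
          exact List.mem_of_mem_drop hx)
      rw [Walk.length_append, Walk.length_cons, Walk.take_length, Walk.drop_length] at this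
      have h3 : i ⊓ q.length = i := min_eq_left (by omega)
      omega
  intro x y hx hy hadj
  obtain ⟨i, rfl, hi⟩ := Walk.mem_support_iff_exists_getVert.1 hx
  obtain ⟨j, rfl, hj⟩ := Walk.mem_support_iff_exists_getVert.1 hy
  rcases lt_trichotomy i j with h | h | h
  · exact key i j h hj hadj
  · subst h; exact absurd hadj (G.loopless.irrefl _)
  · exact (key j i h hi hadj.symm).symm

/-- Two disjoint anticomplete walks linking neighbours of `a` and `b`. -/
def TwoW {V : Type*} (G : SimpleGraph V) (a b a' a'' b' b'' : V) : Prop :=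
  ∃ y y' : V, ((y = b' ∧ y' = b'') ∨ (y = b'' ∧ y' = b')) ∧
    ∃ (p : G.Walk a' y) (q : G.Walk a'' y'),
      (∀ u ∈ p.support, u ≠ a ∧ u ≠ b) ∧ (∀ u ∈ q.support, u ≠ a ∧ u ≠ b) ∧
      (∀ u ∈ p.support, u ∉ q.support) ∧ ∀ u ∈ p.support, ∀ v ∈ q.support, ¬ G.Adj u v

theorem walk_split {V : Type*} (G : SimpleGraph V) {a b : V} (hab : a ≠ b)
    (hn : ¬ G.Adj a b) (p : G.Walk a b) :
    ∃ (x y : V) (h : G.Adj a x) (q : G.Walk x y) (h' : G.Adj y b),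
      p = Walk.cons h (q.concat h') := by
  cases p with
  | nil => exact absurd rfl hab
  | cons h q =>
    cases q with
    | nil => exact absurd h hn
    | cons h2 r =>
      obtain ⟨y, q, h', e⟩ := Walk.exists_cons_eq_concat h2 r
      exact ⟨_, y, h, q, h', by rw [e]⟩

theorem twoW_of_hole {V : Type*} [DecidableEq V] (G : SimpleGraph V)
    (a b a' a'' b' b'' : V)
    (hab : a ≠ b) (hnadj : ¬ G.Adj a b)
    (hdega : ∀ v : V, G.Adj a v → v = a' ∨ v = a'')
    (hdegb : ∀ v : V, G.Adj b v → v = b' ∨ v = b'')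
    (h : ∃ (v : V) (c : G.Walk v v), IsHoleW G c ∧ a ∈ c.support ∧ b ∈ c.support) :
    TwoW G a b a' a'' b' b'' := by
  obtain ⟨v, c, ⟨hc, -, hind⟩, hac, hbc⟩ := h
  have hc' := hc.rotate hac
  have hb' : b ∈ (c.rotate a hac).support := (Walk.mem_support_rotate_iff ..).2 hbc
  have hind' : ∀ x y : V, x ∈ (c.rotate a hac).support → y ∈ (c.rotate a hac).support →
      G.Adj x y → s(x, y) ∈ (c.rotate a hac).edges := by
    intro x y hx hy hxy
    rw [← Walk.adj_toSubgraph_iff_mem_edges, Walk.toSubgraph_rotate]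
    exact hind x y ((Walk.mem_support_rotate_iff ..).1 hx)
      ((Walk.mem_support_rotate_iff ..).1 hy) hxy
  generalize c.rotate a hac = d at hc' hb' hind'
  obtain ⟨x, y, h1, q1, h2, e1⟩ := walk_split G hab hnadj (d.takeUntil b hb')
  obtain ⟨y', x', h3, q2, h4, e2⟩ :=
    walk_split G hab.symm (fun h => hnadj h.symm) (d.dropUntil b hb')
  have hd := d.take_spec hb'
  rw [e1, e2] at hd
  subst hd
  have hnd := hc'.support_nodup
  simp only [Walk.support_append, Walk.support_cons, Walk.support_concat, List.tail_cons,
    List.cons_append, Walk.edges_append, Walk.edges_cons, Walk.edges_concat] at hnd hind'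
  have hq1 : ∀ u ∈ q1.support, u ≠ a ∧ u ≠ b := by
    intro u hu; constructor <;> rintro rfl <;> simp [List.nodup_append] at hnd <;> grind
  have hq2 : ∀ u ∈ q2.support, u ≠ a ∧ u ≠ b := by
    intro u hu; constructor <;> rintro rfl <;> simp [List.nodup_append] at hnd <;> grind
  have hdis : ∀ u ∈ q1.support, u ∉ q2.support := by
    intro u hu hu'; simp [List.nodup_append] at hnd; grind
  have hanti : ∀ u ∈ q1.support, ∀ v ∈ q2.support, ¬ G.Adj u v := by
    intro u hu v hv huv
    have := hind' u v (by simp [hu]) (by simp [hv]) huv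
    simp only [List.mem_cons, List.mem_append, List.concat_eq_append, List.not_mem_nil,
      or_false, Sym2.eq_iff] at this
    have A := hq1 u hu
    have B := hq2 v hv
    have C := fun h => q1.snd_mem_support_of_mem_edges (t := u) (u := v) h
    have D := fun h => q2.fst_mem_support_of_mem_edges (t := u) (u := v) h
    have E := hdis u hu
    have F := fun h => hdis v h
    grind
  have hx := hdega x h1
  have hx' := hdega x' h4.symm
  have hy := hdegb y h2.symm
  have hy' := hdegb y' h3
  have hxx : x ≠ x' := fun e => hdis x q1.start_mem_support (e ▸ q2.end_mem_support)
  have hyy : y ≠ y' := fun e => hdis y q1.end_mem_support (e ▸ q2.start_mem_support)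
  rcases hx with rfl | rfl
  · obtain rfl : x' = a'' := by grind
    exact ⟨y, y', by grind, q1, q2.reverse, hq1, by simpa using hq2, by simpa using hdis,
      by simpa using hanti⟩
  · obtain rfl : x' = a' := by grind
    exact ⟨y', y, by grind, q2.reverse, q1, by simpa using hq2, hq1,
      fun u hu hu' => hdis u hu' (by simpa using hu),
      fun u hu v hv huv => hanti v hv u (by simpa using hu) huv.symm⟩

theorem hole_of_twoW {V : Type*} (G : SimpleGraph V)
    (a b a' a'' b' b'' : V)
    (hab : a ≠ b) (hnadj : ¬ G.Adj a b)
    (ha' : G.Adj a a') (ha'' : G.Adj a a'')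
    (hdega : ∀ v : V, G.Adj a v → v = a' ∨ v = a'')
    (hb' : G.Adj b b') (hb'' : G.Adj b b'')
    (hdegb : ∀ v : V, G.Adj b v → v = b' ∨ v = b'')
    (h : TwoW G a b a' a'' b' b'') :
    ∃ (v : V) (c : G.Walk v v), IsHoleW G c ∧ a ∈ c.support ∧ b ∈ c.support := by
  obtain ⟨y, y', hyy, p, q, hp, hq, hd, han⟩ := h
  obtain ⟨p, ⟨hpp, hpi⟩, hps⟩ := exists_induced_sub G p
  obtain ⟨q, ⟨hqp, hqi⟩, hqs⟩ := exists_induced_sub G q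
  replace hp := fun u hu => hp u (hps u hu)
  replace hq := fun u hu => hq u (hqs u hu)
  replace hd := fun u hu hu' => hd u (hps u hu) (hqs u hu')
  replace han := fun u hu v hv => han u (hps u hu) v (hqs v hv)
  have hyb : G.Adj y b := by rcases hyy with h | h <;> simp [h, hb'.symm, hb''.symm]
  have hyb' : G.Adj b y' := by rcases hyy with h | h <;> simp [h, hb', hb'']
  have hdegb' : ∀ v : V, G.Adj b v → v = y ∨ v = y' := by
    intro v hv; have := hdegb v hv; grind
  have hpe1 := fun u v h => p.fst_mem_support_of_mem_edges (t := u) (u := v) h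
  have hpe2 := fun u v h => p.snd_mem_support_of_mem_edges (t := u) (u := v) h
  have hqe1 := fun u v h => q.fst_mem_support_of_mem_edges (t := u) (u := v) h
  have hqe2 := fun u v h => q.snd_mem_support_of_mem_edges (t := u) (u := v) h
  have hne : a' ≠ a'' := fun e => hd a' p.start_mem_support (e ▸ q.start_mem_support)
  have hpn := hpp.support_nodup
  have hqn := hqp.support_nodup
  have hps1 := p.start_mem_support
  have hpe := p.end_mem_support
  have hqs1 := q.start_mem_support
  have hqe := q.end_mem_support
  simp only [Walk.adj_toSubgraph_iff_mem_edges] at hpi hqi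
  refine ⟨a, Walk.cons ha' ((p.concat hyb).append (Walk.cons hyb' (q.reverse.concat ha''.symm))),
    ⟨?_, ?_, ?_⟩, ?_, ?_⟩
  · rw [Walk.cons_isCycle_iff, Walk.isPath_def]
    constructor
    · simp [Walk.support_append, Walk.support_concat, List.nodup_append]
      grind
    · simp [Walk.edges_append, Walk.edges_concat, Sym2.eq_iff]
      grind
  · simp [Walk.length_append]
    omega
  · intro u v hu hv huv
    rw [Walk.adj_toSubgraph_iff_mem_edges]
    simp [Walk.support_append, Walk.support_concat] at hu hv
    simp [Walk.edges_append, Walk.edges_concat, Sym2.eq_iff]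
    have hs := huv.symm
    have A := hdega u
    have A2 := hdega v
    have B := hdegb' u
    have B2 := hdegb' v
    have := huv.ne
    grind
  · simp
  · simp [Walk.support_append, Walk.support_concat]

section gadget

variable {V : Type*} [DecidableEq V] (G : SimpleGraph V) (a b a' a'' b' b'' : V)

theorem pg_ll (u v : {v : V // v ≠ a ∧ v ≠ b}) :
    (prismGadget G a b a' a'' b' b'').Adj (Sum.inl u) (Sum.inl v) ↔ G.Adj u.1 v.1 := by
  simp only [prismGadget, SimpleGraph.fromRel_adj]
  constructor
  · rintro ⟨-, h | h⟩
    · exact h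
    · exact h.symm
  · intro h
    exact ⟨fun e => h.ne (by simpa using congrArg (fun z => Sum.elim (fun w => w.1) (fun _ => a) z) e),
      Or.inl h⟩

theorem pg_rl (i : Fin 10) (u : {v : V // v ≠ a ∧ v ≠ b}) :
    (prismGadget G a b a' a'' b' b'').Adj (Sum.inr i) (Sum.inl u) ↔
      ((i = 3 ∧ u.1 = a') ∨ (i = 4 ∧ u.1 = a'') ∨ (i = 8 ∧ u.1 = b') ∨ (i = 9 ∧ u.1 = b'')) := by
  simp [prismGadget, SimpleGraph.fromRel_adj]

theorem pg_lr (i : Fin 10) (u : {v : V // v ≠ a ∧ v ≠ b}) :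
    (prismGadget G a b a' a'' b' b'').Adj (Sum.inl u) (Sum.inr i) ↔
      ((i = 3 ∧ u.1 = a') ∨ (i = 4 ∧ u.1 = a'') ∨ (i = 8 ∧ u.1 = b') ∨ (i = 9 ∧ u.1 = b'')) := by
  simp [prismGadget, SimpleGraph.fromRel_adj]

/-- Adjacency between new vertices, as a boolean-friendly relation. -/
def gadRel (i j : Fin 10) : Prop :=
  (i = 0 ∧ j = 1) ∨ (i = 0 ∧ j = 2) ∨ (i = 1 ∧ j = 2) ∨ (i = 1 ∧ j = 3) ∨
  (i = 2 ∧ j = 4) ∨ (i = 5 ∧ j = 6) ∨ (i = 5 ∧ j = 7) ∨ (i = 6 ∧ j = 7) ∨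
  (i = 6 ∧ j = 8) ∨ (i = 7 ∧ j = 9) ∨ (i = 0 ∧ j = 5)

instance (i j : Fin 10) : Decidable (gadRel i j) := by unfold gadRel; infer_instance

theorem pg_rr (i j : Fin 10) :
    (prismGadget G a b a' a'' b' b'').Adj (Sum.inr i) (Sum.inr j) ↔
      (gadRel i j ∨ gadRel j i) := by
  have h : ∀ i : Fin 10, ¬ gadRel i i := by decide
  simp only [prismGadget, SimpleGraph.fromRel_adj]
  change _ ∧ (gadRel i j ∨ gadRel j i) ↔ _
  constructor
  · exact fun h => h.2
  · intro h'
    refine ⟨?_, h'⟩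
    intro e
    obtain rfl : i = j := by simpa using e
    have := h i
    tauto

set_option maxRecDepth 100000 in
set_option maxHeartbeats 1000000 in
theorem gad_tri : ∀ i j k : Fin 10, (gadRel i j ∨ gadRel j i) → (gadRel j k ∨ gadRel k j) →
    (gadRel i k ∨ gadRel k i) →
    (i.1 < 3 ∧ j.1 < 3 ∧ k.1 < 3) ∨
    ((5 ≤ i.1 ∧ i.1 < 8) ∧ (5 ≤ j.1 ∧ j.1 < 8) ∧ (5 ≤ k.1 ∧ k.1 < 8)) := by
  decide

theorem pg_tri (htf : ∀ x y z : V, ¬ (G.Adj x y ∧ G.Adj y z ∧ G.Adj x z))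
    (x y z : {v : V // v ≠ a ∧ v ≠ b} ⊕ Fin 10)
    (h1 : (prismGadget G a b a' a'' b' b'').Adj x y)
    (h2 : (prismGadget G a b a' a'' b' b'').Adj y z)
    (h3 : (prismGadget G a b a' a'' b' b'').Adj x z) :
    ∃ i j k : Fin 10, x = Sum.inr i ∧ y = Sum.inr j ∧ z = Sum.inr k ∧
    ((i.1 < 3 ∧ j.1 < 3 ∧ k.1 < 3) ∨
    ((5 ≤ i.1 ∧ i.1 < 8) ∧ (5 ≤ j.1 ∧ j.1 < 8) ∧ (5 ≤ k.1 ∧ k.1 < 8))) := by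
  have hd : ∀ i j : Fin 10, (gadRel i j ∨ gadRel j i) → (i = 3 ∨ i = 4 ∨ i = 8 ∨ i = 9) →
      (j = 3 ∨ j = 4 ∨ j = 8 ∨ j = 9) → False := by decide
  rcases x with x | i <;> rcases y with y | j <;> rcases z with z | k
  all_goals simp only [pg_ll, pg_rl, pg_lr, pg_rr] at h1 h2 h3
  · exact absurd ⟨h1, h2, h3⟩ (htf _ _ _)
  · have := h1.ne; grind
  · have := h3.ne; grind
  · have := hd _ _ h2; grind
  · have := h2.ne; grind
  · have := hd _ _ h3; grind
  · have := hd _ _ h1; grind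
  · exact ⟨i, j, k, rfl, rfl, rfl, gad_tri i j k h1 h2 h3⟩

theorem exit_walk (x : V) (hx : x ≠ a ∧ x ≠ b) (i1 i2 i3 i4 k : Fin 10)
    (hi : (i1 = 1 ∧ i2 = 2 ∧ i3 = 3 ∧ i4 = 4 ∧ x = a') ∨
      (i1 = 2 ∧ i2 = 1 ∧ i3 = 4 ∧ i4 = 3 ∧ x = a'')) (hk : 5 ≤ k.1)
    (P : (prismGadget G a b a' a'' b' b'').Walk (Sum.inr i1) (Sum.inr k))
    (h0 : Sum.inr 0 ∉ P.support) (h2 : Sum.inr i2 ∉ P.support) (h4 : Sum.inr i4 ∉ P.support) :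
    ∃ y, (y = b' ∨ y = b'') ∧ ∃ q : G.Walk x y,
      ∀ u ∈ q.support, ∃ h : u ≠ a ∧ u ≠ b, Sum.inl ⟨u, h⟩ ∈ P.support := by
  let R : Set ({v : V // v ≠ a ∧ v ≠ b} ⊕ Fin 10) := fun z =>
    z = Sum.inr i1 ∨ z = Sum.inr i3 ∨ ∃ w, z = Sum.inl w ∧ ∃ q : G.Walk x w.1,
      ∀ u ∈ q.support, ∃ h : u ≠ a ∧ u ≠ b, Sum.inl ⟨u, h⟩ ∈ P.support
  obtain ⟨d, hd, hd1, hd2⟩ := P.exists_boundary_dart R (Or.inl rfl) (by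
    rintro (h | h | ⟨w, h, -⟩)
    · have : k = i1 := by simpa using h
      grind
    · have : k = i3 := by simpa using h
      grind
    · simp at h)
  have hs2 : d.snd ∈ P.support := P.dart_snd_mem_support_of_mem_darts hd
  have hadj := d.adj
  obtain ⟨⟨z1, z2⟩, hz⟩ := d
  simp only at hd1 hd2 hs2 hadj
  have n1 : z2 ≠ Sum.inr i1 := fun h => hd2 (Or.inl h)
  have n3 : z2 ≠ Sum.inr i3 := fun h => hd2 (Or.inr (Or.inl h))
  have n0 : z2 ≠ Sum.inr 0 := fun h => h0 (h ▸ hs2)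
  have n2 : z2 ≠ Sum.inr i2 := fun h => h2 (h ▸ hs2)
  have n4 : z2 ≠ Sum.inr i4 := fun h => h4 (h ▸ hs2)
  rcases hd1 with h | h | ⟨w, h, q, hq⟩
  · subst h
    exfalso
    rcases z2 with v | j
    · rw [pg_rl] at hadj; grind
    · rw [pg_rr] at hadj
      have m : ∀ j : Fin 10, ((gadRel 1 j ∨ gadRel j 1) → j = 0 ∨ j = 2 ∨ j = 3) ∧
        ((gadRel 2 j ∨ gadRel j 2) → j = 0 ∨ j = 1 ∨ j = 4) := by decide
      have := m j
      grind
  · subst h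
    exfalso
    rcases z2 with v | j
    · rw [pg_rl] at hadj
      have hv : v.1 = x := by grind
      apply hd2
      obtain ⟨v, hv'⟩ := v
      simp only at hv
      subst hv
      exact Or.inr (Or.inr ⟨⟨v, hv'⟩, rfl, Walk.nil, by simpa using ⟨hv', hs2⟩⟩)
    · rw [pg_rr] at hadj
      have m : ∀ j : Fin 10, ((gadRel 3 j ∨ gadRel j 3) → j = 1) ∧
        ((gadRel 4 j ∨ gadRel j 4) → j = 2) := by decide
      have := m j
      grind
  · subst h
    rcases z2 with v | j
    · exfalso
      rw [pg_ll] at hadj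
      apply hd2
      refine Or.inr (Or.inr ⟨v, rfl, q.concat hadj, ?_⟩)
      intro u hu
      rw [Walk.support_concat, List.mem_append, List.mem_singleton] at hu
      rcases hu with hu | rfl
      · exact hq u hu
      · exact ⟨v.2, hs2⟩
    · rw [pg_lr] at hadj
      refine ⟨w.1, ?_, q, hq⟩
      grind

theorem twoW_of_pair (hab' : a' ≠ a ∧ a' ≠ b) (hab'' : a'' ≠ a ∧ a'' ≠ b)
    (k l : Fin 10) (hk : 5 ≤ k.1 ∧ k.1 < 8) (hl : 5 ≤ l.1 ∧ l.1 < 8)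
    (P : (prismGadget G a b a' a'' b' b'').Walk (Sum.inr 1) (Sum.inr k))
    (Q : (prismGadget G a b a' a'' b' b'').Walk (Sum.inr 2) (Sum.inr l))
    (hPQ : PriPair _ _ _ _ _ P Q)
    (hP0 : Sum.inr 0 ∉ P.support) (hQ0 : Sum.inr 0 ∉ Q.support) :
    TwoW G a b a' a'' b' b'' := by
  obtain ⟨hdis, hcr⟩ := hPQ
  have hP2 : Sum.inr 2 ∉ P.support := fun h => hdis _ h Q.start_mem_support
  have hQ1 : Sum.inr 1 ∉ Q.support := fun h => hdis _ P.start_mem_support h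
  have hP4 : Sum.inr 4 ∉ P.support := by
    intro h
    have := hcr _ h _ Q.start_mem_support (by rw [pg_rr]; decide)
    simp at this
    grind
  have hQ3 : Sum.inr 3 ∉ Q.support := by
    intro h
    have := hcr _ P.start_mem_support _ h (by rw [pg_rr]; decide)
    simp at this
    grind
  obtain ⟨y, hy, p, hp⟩ := exit_walk G a b a' a'' b' b'' a' hab' 1 2 3 4 k (by simp) hk.1 P
    hP0 hP2 hP4
  obtain ⟨y', hy', q, hq⟩ := exit_walk G a b a' a'' b' b'' a'' hab'' 2 1 4 3 l (by simp) hl.1 Q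
    hQ0 hQ1 hQ3
  have hd : ∀ u ∈ p.support, u ∉ q.support := by
    intro u hu hu'
    obtain ⟨h, h1⟩ := hp u hu
    obtain ⟨_, h2⟩ := hq u hu'
    exact hdis _ h1 h2
  have hyy : y ≠ y' := fun e => hd y p.end_mem_support (e ▸ q.end_mem_support)
  refine ⟨y, y', by grind, p, q, fun u hu => (hp u hu).1, fun u hu => (hq u hu).1, hd, ?_⟩
  intro u hu v hv huv
  obtain ⟨h, h1⟩ := hp u hu
  obtain ⟨h', h2⟩ := hq v hv
  have := hcr _ h1 _ h2 (by rw [pg_ll]; exact huv)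
  simp at this

theorem PriPair.symm' {W : Type*} {H : SimpleGraph W} {ai bi aj bj : W} {P : H.Walk ai bi}
    {Q : H.Walk aj bj} (h : PriPair H ai bi aj bj P Q) : PriPair H aj bj ai bi Q P :=
  ⟨fun x hx hx' => h.1 x hx' hx, fun x hx y hy hxy => by
    have := h.2 y hy x hx hxy.symm
    tauto⟩

theorem PriPair.rev' {W : Type*} {H : SimpleGraph W} {ai bi aj bj : W} {P : H.Walk ai bi}
    {Q : H.Walk aj bj} (h : PriPair H ai bi aj bj P Q) :
    PriPair H bi ai bj aj P.reverse Q.reverse :=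
  ⟨fun x hx hx' => h.1 x (by simpa using hx) (by simpa using hx'), fun x hx y hy hxy => by
    have := h.2 x (by simpa using hx) y (by simpa using hy) hxy
    tauto⟩

theorem twoW_of_triple (hab' : a' ≠ a ∧ a' ≠ b) (hab'' : a'' ≠ a ∧ a'' ≠ b)
    (i j k l m n : Fin 10) (hi : i.1 < 3) (hj : j.1 < 3) (hk : k.1 < 3)
    (hl : 5 ≤ l.1 ∧ l.1 < 8) (hm : 5 ≤ m.1 ∧ m.1 < 8) (hn : 5 ≤ n.1 ∧ n.1 < 8)
    (hij : i ≠ j) (hjk : j ≠ k) (hik : i ≠ k)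
    (P : (prismGadget G a b a' a'' b' b'').Walk (Sum.inr i) (Sum.inr l))
    (Q : (prismGadget G a b a' a'' b' b'').Walk (Sum.inr j) (Sum.inr m))
    (R : (prismGadget G a b a' a'' b' b'').Walk (Sum.inr k) (Sum.inr n))
    (hPQ : PriPair _ _ _ _ _ P Q) (hPR : PriPair _ _ _ _ _ P R) (hQR : PriPair _ _ _ _ _ Q R) :
    TwoW G a b a' a'' b' b'' := by
  have h3 : ∀ i : Fin 10, i.1 < 3 → i = 0 ∨ i = 1 ∨ i = 2 := by decide
  rcases h3 i hi with rfl | rfl | rfl <;> rcases h3 j hj with rfl | rfl | rfl <;>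
    rcases h3 k hk with rfl | rfl | rfl <;> first
    | exact absurd rfl hij
    | exact absurd rfl hik
    | exact absurd rfl hjk
    | skip
  · exact twoW_of_pair G a b a' a'' b' b'' hab' hab'' _ _ hm hn Q R hQR
      (hPQ.1 _ P.start_mem_support) (hPR.1 _ P.start_mem_support)
  · exact twoW_of_pair G a b a' a'' b' b'' hab' hab'' _ _ hn hm R Q hQR.symm'
      (hPR.1 _ P.start_mem_support) (hPQ.1 _ P.start_mem_support)
  · exact twoW_of_pair G a b a' a'' b' b'' hab' hab'' _ _ hl hn P R hPR
      (hPQ.symm'.1 _ Q.start_mem_support) (hQR.1 _ Q.start_mem_support)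
  · exact twoW_of_pair G a b a' a'' b' b'' hab' hab'' _ _ hl hm P Q hPQ
      (hPR.symm'.1 _ R.start_mem_support) (hQR.symm'.1 _ R.start_mem_support)
  · exact twoW_of_pair G a b a' a'' b' b'' hab' hab'' _ _ hn hl R P hPR.symm'
      (hQR.1 _ Q.start_mem_support) (hPQ.symm'.1 _ Q.start_mem_support)
  · exact twoW_of_pair G a b a' a'' b' b'' hab' hab'' _ _ hm hl Q P hPQ.symm'
      (hQR.symm'.1 _ R.start_mem_support) (hPR.symm'.1 _ R.start_mem_support)

theorem three_small (i j k l : Fin 10) (h : i ≠ j) (h' : i ≠ k) (h'' : j ≠ k)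
    (hl : l ≠ i) (hl' : l ≠ j) (hl'' : l ≠ k) :
    ¬ (i.1 < 3 ∧ j.1 < 3 ∧ k.1 < 3 ∧ l.1 < 3) ∧
    ¬ ((5 ≤ i.1 ∧ i.1 < 8) ∧ (5 ≤ j.1 ∧ j.1 < 8) ∧ (5 ≤ k.1 ∧ k.1 < 8) ∧
      (5 ≤ l.1 ∧ l.1 < 8)) := by
  omega

theorem twoW_of_prism (htf : ∀ x y z : V, ¬ (G.Adj x y ∧ G.Adj y z ∧ G.Adj x z))
    (hab' : a' ≠ a ∧ a' ≠ b) (hab'' : a'' ≠ a ∧ a'' ≠ b)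
    (h : HasPrism (prismGadget G a b a' a'' b' b'')) : TwoW G a b a' a'' b' b'' := by
  obtain ⟨x1, x2, x3, y1, y2, y3, P, Q, R, -, -, -, h12, h23, h13, g12, g23, g13,
    n1, n2, n3, hPQ, hPR, hQR⟩ := h
  obtain ⟨i, j, k, rfl, rfl, rfl, hijk⟩ := pg_tri G a b a' a'' b' b'' htf _ _ _ h12 h23 h13
  obtain ⟨l, m, n, rfl, rfl, rfl, hlmn⟩ := pg_tri G a b a' a'' b' b'' htf _ _ _ g12 g23 g13
  have e1 : i ≠ j := fun e => h12.ne (congrArg _ e)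
  have e2 : j ≠ k := fun e => h23.ne (congrArg _ e)
  have e3 : i ≠ k := fun e => h13.ne (congrArg _ e)
  have f1 : l ≠ m := fun e => g12.ne (congrArg _ e)
  have f2 : m ≠ n := fun e => g23.ne (congrArg _ e)
  have f3 : l ≠ n := fun e => g13.ne (congrArg _ e)
  have d1 : l ≠ i := fun e => n1 (congrArg _ e.symm)
  have d2 : l ≠ j := fun e => hPQ.1 _ P.end_mem_support (e ▸ Q.start_mem_support)
  have d3 : l ≠ k := fun e => hPR.1 _ P.end_mem_support (e ▸ R.start_mem_support)
  have := three_small i j k l e1 e3 e2 d1 d2 d3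
  rcases hijk with ⟨hi, hj, hk⟩ | ⟨hi, hj, hk⟩ <;> rcases hlmn with ⟨hl, hm, hn⟩ | ⟨hl, hm, hn⟩
  · tauto
  · exact twoW_of_triple G a b a' a'' b' b'' hab' hab'' i j k l m n hi hj hk hl hm hn e1 e2 e3
      P Q R hPQ hPR hQR
  · exact twoW_of_triple G a b a' a'' b' b'' hab' hab'' l m n i j k hl hm hn hi hj hk f1 f2 f3
      P.reverse Q.reverse R.reverse hPQ.rev' hPR.rev' hQR.rev'
  · tauto

theorem lift_walk {x y : V} (p : G.Walk x y) (hp : ∀ u ∈ p.support, u ≠ a ∧ u ≠ b)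
    (hx : x ≠ a ∧ x ≠ b) (hy : y ≠ a ∧ y ≠ b) :
    ∃ q : (prismGadget G a b a' a'' b' b'').Walk (Sum.inl ⟨x, hx⟩) (Sum.inl ⟨y, hy⟩),
      ∀ z ∈ q.support, ∃ u, z = Sum.inl u ∧ u.1 ∈ p.support := by
  induction p with
  | nil => exact ⟨Walk.nil, by simpa using hx⟩
  | @cons u v w h p ih =>
    have hv : v ≠ a ∧ v ≠ b := hp v (by simp)
    obtain ⟨q, hq⟩ := ih (fun u hu => hp u (by simp [hu])) hv hy
    refine ⟨Walk.cons ((pg_ll ..).2 h) q, ?_⟩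
    intro z hz
    rw [Walk.support_cons, List.mem_cons] at hz
    rcases hz with rfl | hz
    · exact ⟨_, rfl, by simp⟩
    · obtain ⟨u, hu, hu'⟩ := hq z hz
      exact ⟨u, hu, by simp [hu']⟩

theorem gad_walk {x y : V} (p : G.Walk x y) (hp : ∀ u ∈ p.support, u ≠ a ∧ u ≠ b)
    (i1 i3 k8 k6 : Fin 10)
    (hi : (i1 = 1 ∧ i3 = 3 ∧ x = a') ∨ (i1 = 2 ∧ i3 = 4 ∧ x = a''))
    (hk : (k6 = 6 ∧ k8 = 8 ∧ y = b') ∨ (k6 = 7 ∧ k8 = 9 ∧ y = b'')) :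
    ∃ q : (prismGadget G a b a' a'' b' b'').Walk (Sum.inr i1) (Sum.inr k6),
      IsInducedPathW _ q ∧
      ∀ z ∈ q.support, z = Sum.inr i1 ∨ z = Sum.inr i3 ∨ z = Sum.inr k8 ∨ z = Sum.inr k6 ∨
        ∃ u, z = Sum.inl u ∧ u.1 ∈ p.support := by
  obtain ⟨q, hq⟩ := lift_walk G a b a' a'' b' b'' p hp (hp _ p.start_mem_support)
    (hp _ p.end_mem_support)
  have e1 : (prismGadget G a b a' a'' b' b'').Adj (Sum.inr i1) (Sum.inr i3) := by
    rw [pg_rr]; rcases hi with ⟨rfl, rfl, -⟩ | ⟨rfl, rfl, -⟩ <;> decide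
  have e2 : (prismGadget G a b a' a'' b' b'').Adj (Sum.inr i3)
      (Sum.inl ⟨x, hp _ p.start_mem_support⟩) := by
    rw [pg_rl]; grind
  have e3 : (prismGadget G a b a' a'' b' b'').Adj
      (Sum.inl ⟨y, hp _ p.end_mem_support⟩) (Sum.inr k8) := by
    rw [pg_lr]; grind
  have e4 : (prismGadget G a b a' a'' b' b'').Adj (Sum.inr k8) (Sum.inr k6) := by
    rw [pg_rr]; rcases hk with ⟨rfl, rfl, -⟩ | ⟨rfl, rfl, -⟩ <;> decide
  obtain ⟨r, hr, hrs⟩ := exists_induced_sub _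
    (Walk.cons e1 (Walk.cons e2 ((q.concat e3).concat e4)))
  refine ⟨r, hr, ?_⟩
  intro z hz
  have := hrs z hz
  simp only [Walk.support_cons, Walk.support_concat, List.mem_cons, List.mem_append,
    List.not_mem_nil, or_false] at this
  have := hq z
  tauto

theorem prism_of_twoW (h : TwoW G a b a' a'' b' b'') :
    HasPrism (prismGadget G a b a' a'' b' b'') := by
  obtain ⟨y, y', hyy, p, q, hp, hq, hd, han⟩ := h
  obtain ⟨k8, k6, k9, k7, hk⟩ : ∃ k8 k6 k9 k7 : Fin 10,
      (k8 = 8 ∧ k6 = 6 ∧ k9 = 9 ∧ k7 = 7 ∧ y = b' ∧ y' = b'') ∨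
      (k8 = 9 ∧ k6 = 7 ∧ k9 = 8 ∧ k7 = 6 ∧ y = b'' ∧ y' = b') := by
    rcases hyy with h | h
    · exact ⟨8, 6, 9, 7, by simp [h]⟩
    · exact ⟨9, 7, 8, 6, by simp [h]⟩
  have ma' := p.start_mem_support
  have ma'' := q.start_mem_support
  have my := p.end_mem_support
  have my' := q.end_mem_support
  obtain ⟨P, hP, hPs⟩ := gad_walk G a b a' a'' b' b'' p hp 1 3 k8 k6 (by simp) (by grind)
  obtain ⟨Q, hQ, hQs⟩ := gad_walk G a b a' a'' b' b'' q hq 2 4 k9 k7 (by simp) (by grind)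
  have h05 : (prismGadget G a b a' a'' b' b'').Adj (Sum.inr 0) (Sum.inr 5) := by
    rw [pg_rr]; decide
  refine ⟨Sum.inr 0, Sum.inr 1, Sum.inr 2, Sum.inr 5, Sum.inr k6, Sum.inr k7,
    Walk.cons h05 Walk.nil, P, Q, ⟨?_, ?_⟩, hP, hQ, ?_, ?_, ?_, ?_, ?_, ?_, ?_, ?_, ?_,
    ⟨?_, ?_⟩, ⟨?_, ?_⟩, ⟨?_, ?_⟩⟩
  · simp
  · intro x y hx hy hxy
    rw [Walk.adj_toSubgraph_iff_mem_edges]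
    simp at hx hy ⊢
    have := hxy.ne
    grind
  · rw [pg_rr]; decide
  · rw [pg_rr]; decide
  · rw [pg_rr]; decide
  · rw [pg_rr]; rcases hk with ⟨rfl, rfl, rfl, rfl, -⟩ | ⟨rfl, rfl, rfl, rfl, -⟩ <;> decide
  · rw [pg_rr]; rcases hk with ⟨rfl, rfl, rfl, rfl, -⟩ | ⟨rfl, rfl, rfl, rfl, -⟩ <;> decide
  · rw [pg_rr]; rcases hk with ⟨rfl, rfl, rfl, rfl, -⟩ | ⟨rfl, rfl, rfl, rfl, -⟩ <;> decide
  · simp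
  · simp; grind
  · simp; grind
  · intro x hx hx'
    have := hPs x hx'
    simp at hx
    grind
  · intro x hx z hz hxz
    have := hPs z hz
    simp at hx
    rcases hk with ⟨rfl, rfl, rfl, rfl, -, -⟩ | ⟨rfl, rfl, rfl, rfl, -, -⟩ <;>
    rcases hx with rfl | rfl <;> rcases this with rfl | rfl | rfl | rfl | ⟨u, rfl, hu⟩ <;>
    simp [pg_rr, pg_rl, gadRel] at hxz ⊢
  · intro x hx hx'
    have := hQs x hx'
    simp at hx
    grind
  · intro x hx z hz hxz
    have := hQs z hz
    simp at hx
    rcases hk with ⟨rfl, rfl, rfl, rfl, -, -⟩ | ⟨rfl, rfl, rfl, rfl, -, -⟩ <;>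
    rcases hx with rfl | rfl <;> rcases this with rfl | rfl | rfl | rfl | ⟨u, rfl, hu⟩ <;>
    simp [pg_rr, pg_rl, gadRel] at hxz ⊢
  · intro x hx hx'
    have A := hPs x hx
    have B := hQs x hx'
    grind
  · intro x hx z hz hxz
    have A := hPs x hx
    have B := hQs z hz
    rcases hk with ⟨rfl, rfl, rfl, rfl, rfl, rfl⟩ | ⟨rfl, rfl, rfl, rfl, rfl, rfl⟩ <;>
    rcases A with rfl | rfl | rfl | rfl | ⟨u, rfl, hu⟩ <;>
    rcases B with rfl | rfl | rfl | rfl | ⟨v, rfl, hv⟩ <;>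
    simp [pg_rr, pg_rl, pg_lr, pg_ll, gadRel] at hxz ⊢ <;> grind

end gadget
/-- Let `G` be a triangle-free graph, and let `a, b` be two
non-adjacent vertices of `G`, each of degree `2`, with neighbours `a', a''` and
`b', b''` respectively. Then the graph `G'` obtained by the gadget construction
contains an induced prism if and only if `G` has a hole passing through both `a`
and `b`. -/
theorem gadget_prism_iff_hole_through_ab
    {V : Type*} [Fintype V] [DecidableEq V] (G : SimpleGraph V)
    (a b a' a'' b' b'' : V)
    (htf : ∀ x y z : V, ¬ (G.Adj x y ∧ G.Adj y z ∧ G.Adj x z))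
    (hab : a ≠ b) (hnadj : ¬ G.Adj a b)
    (ha' : G.Adj a a') (ha'' : G.Adj a a'') (ha : a' ≠ a'')
    (hdega : ∀ v : V, G.Adj a v → v = a' ∨ v = a'')
    (hb' : G.Adj b b') (hb'' : G.Adj b b'') (hb : b' ≠ b'')
    (hdegb : ∀ v : V, G.Adj b v → v = b' ∨ v = b'') :
    HasPrism (prismGadget G a b a' a'' b' b'') ↔
      ∃ (v : V) (c : G.Walk v v), IsHoleW G c ∧ a ∈ c.support ∧ b ∈ c.support := by
  have e1 : a' ≠ a ∧ a' ≠ b := ⟨ha'.ne', fun e => hnadj (e ▸ ha')⟩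
  have e2 : a'' ≠ a ∧ a'' ≠ b := ⟨ha''.ne', fun e => hnadj (e ▸ ha'')⟩
  constructor
  · intro h
    exact hole_of_twoW G a b a' a'' b' b'' hab hnadj ha' ha'' hdega hb' hb'' hdegb
      (twoW_of_prism G a b a' a'' b' b'' htf e1 e2 h)
  · intro h
    exact prism_of_twoW G a b a' a'' b' b''
      (twoW_of_hole G a b a' a'' b' b'' hab hnadj hdega hdegb h)
end
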